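/- arXiv:2006.12312 — 4 statements merged into one kernel-verified Lean document; each statement's English description precedes it below -/
import Mathlib

section
/- For every real parameter a with 0 < a < 1 and every real x > 0, the value of the magnetic (γ = 1/2) metric function in dimensionless form, f(x) = 1 − (a/x)·arctan(x), is strictly positive. Consequently the metric function has no zero on (0,∞), so no horizon forms and the singularity at the origin is naked. -/
open Real

theorem arctan_lt_self_of_pos {x : ℝ} (hx : 0 < x) : Real.arctan x < x := by
  have h := Real.lt_tan (Real.arctan_pos.2 hx) (Real.arctan_lt_pi_div_two x)
  rwa [Real.tan_arctan] at h

theorem magnetic_half_metric_pos {a x : ℝ} (ha₀ : 0 < a) (ha₁ : a < 1) (hx : 0 < x) :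
    0 < 1 - (a / x) * Real.arctan x := by
  rw [sub_pos]
  calc a / x * Real.arctan x < a / x * x :=
        mul_lt_mul_of_pos_left (arctan_lt_self_of_pos hx) (div_pos ha₀ hx)
    _ = a := div_mul_cancel₀ a hx.ne'
    _ < 1 := ha₁

/-- For `0 < a < 1`, the dimensionless magnetic (γ = 1/2) metric function
`f(x) = 1 - (a/x) · arctan x` is strictly positive for every `x > 0`;
consequently it has no zero on `(0, ∞)` (no horizon, naked singularity). -/
theorem magnetic_half_no_horizon (a : ℝ) (ha₀ : 0 < a) (ha₁ : a < 1) :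
    (∀ x : ℝ, 0 < x → 0 < 1 - (a / x) * Real.arctan x) ∧
      ¬ ∃ x : ℝ, 0 < x ∧ 1 - (a / x) * Real.arctan x = 0 := by
  exact ⟨fun _ hx => magnetic_half_metric_pos ha₀ ha₁ hx,
    fun ⟨_, hx, h⟩ => (magnetic_half_metric_pos ha₀ ha₁ hx).ne' h⟩
end

section
/- Let G, M, q, α be real constants with G > 0, q > 0, α > 0, and let f(r) = 1 − 2GM/r + (2G r²/(3α²))·(1 + 2qα/r²)^{3/2} − (2Gq/α)·(1 + r²/(3qα)) for r > 0. Define the shifted mass M̃ = M − 2√2 (qα)^{3/2}/(3α²). Then lim_{r→0⁺} ( f(r) + 2G M̃ / r ) = 1 − 2Gq/α. -/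
open Real Topology Filter

theorem tendsto_sq_add_rpow_sub_div_self {c : ℝ} (hc : 0 < c) (p : ℝ) :
    Tendsto (fun r : ℝ => ((r ^ 2 + c) ^ p - c ^ p) / r) (𝓝[>] 0) (𝓝 0) := by
  have hd : HasDerivAt (fun r : ℝ => (r ^ 2 + c) ^ p) 0 0 := by
    have h := (((hasDerivAt_id (0 : ℝ)).pow 2).add_const c).rpow_const (p := p)
      (Or.inl (by simpa using hc.ne'))
    simpa using h
  refine hd.tendsto_slope_zero_right.congr fun r => ?_
  simp [div_eq_inv_mul]

theorem two_mul_rpow_three_halves {x : ℝ} (hx : 0 ≤ x) :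
    (2 * x) ^ ((3 : ℝ) / 2) = 2 * √2 * x ^ ((3 : ℝ) / 2) := by
  rw [mul_rpow zero_le_two hx, show (3 : ℝ) / 2 = 1 + 1 / 2 by norm_num,
    rpow_add two_pos, rpow_one, ← sqrt_eq_rpow]

theorem sq_mul_one_add_div_sq_rpow_three_halves {c r : ℝ} (hc : 0 ≤ c) (hr : 0 < r) :
    r ^ 2 * (1 + c / r ^ 2) ^ ((3 : ℝ) / 2) = (r ^ 2 + c) ^ ((3 : ℝ) / 2) / r := by
  have hr3 : (r ^ 2) ^ ((3 : ℝ) / 2) = r ^ 3 := by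
    rw [← rpow_natCast, ← rpow_mul hr.le, ← rpow_natCast]
    norm_num
  rw [show 1 + c / r ^ 2 = (r ^ 2 + c) / r ^ 2 by field_simp,
    div_rpow (by positivity) (by positivity), hr3]
  field_simp

/-- Near-origin behaviour of the electrically charged (γ = 1/2) metric function:
with `M̃ = M - 2√2 (qα)^{3/2}/(3α²)`, one has
`f(r) + 2 G M̃ / r → 1 - 2Gq/α` as `r → 0⁺`. -/
theorem electric_near_origin_constant (G M q α : ℝ) (hG : 0 < G) (hq : 0 < q)
    (hα : 0 < α) :
    Filter.Tendsto
      (fun r : ℝ =>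
        (1 - 2 * G * M / r + (2 * G * r ^ 2 / (3 * α ^ 2)) *
            (1 + 2 * q * α / r ^ 2) ^ ((3 : ℝ) / 2)
          - (2 * G * q / α) * (1 + r ^ 2 / (3 * q * α)))
        + 2 * G * (M - 2 * Real.sqrt 2 * (q * α) ^ ((3 : ℝ) / 2) / (3 * α ^ 2)) / r)
      (𝓝[>] 0) (𝓝 (1 - 2 * G * q / α)) := by
  have hc : 0 < 2 * q * α := by positivity
  have hslope := (tendsto_sq_add_rpow_sub_div_self hc (3 / 2)).const_mul (2 * G / (3 * α ^ 2))
  have hpoly : Tendsto (fun r : ℝ => 1 - (2 * G * q / α) * (1 + r ^ 2 / (3 * q * α)))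
      (𝓝[>] 0) (𝓝 (1 - 2 * G * q / α)) := by
    have h : Continuous fun r : ℝ => 1 - (2 * G * q / α) * (1 + r ^ 2 / (3 * q * α)) := by
      fun_prop
    simpa using (h.tendsto 0).mono_left nhdsWithin_le_nhds
  have hsum := hslope.add hpoly
  rw [mul_zero, zero_add] at hsum
  refine hsum.congr' ?_
  filter_upwards [self_mem_nhdsWithin] with r hr
  have hc' : (2 * q * α) ^ ((3 : ℝ) / 2) = 2 * √2 * (q * α) ^ ((3 : ℝ) / 2) := by
    rw [mul_assoc, two_mul_rpow_three_halves (by positivity)]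
  rw [mul_div_right_comm (2 * G) (r ^ 2), mul_assoc (2 * G / (3 * α ^ 2)) (r ^ 2),
    sq_mul_one_add_div_sq_rpow_three_halves hc.le hr, hc']
  ring
end

section
/- Let G, M, q, α be real constants with G > 0, q > 0, α > 0, let f(r) = 1 − 2GM/r + (2G r²/(3α²))·(1 + 2qα/r²)^{3/2} − (2Gq/α)·(1 + r²/(3qα)) for r > 0, and let M̃ = M − 2√2 (qα)^{3/2}/(3α²). Then lim_{r→0⁺} [ f(r) + 2G M̃/r − (1 − 2Gq/α) ] / r = G√(2qα)/α². -/
open Real Topology Filter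

theorem rpow_three_halves {x : ℝ} (hx : 0 ≤ x) : x ^ ((3 : ℝ) / 2) = √x ^ 3 := by
  rw [Real.rpow_div_two_eq_sqrt _ hx]
  exact_mod_cast Real.rpow_natCast (√x) 3

/-- Linear term of the near-origin expansion of the electrically charged (γ = 1/2)
metric function: with `M̃ = M - 2√2 (qα)^{3/2}/(3α²)`, one has
`(f(r) + 2 G M̃/r - (1 - 2Gq/α))/r → G √(2qα)/α²` as `r → 0⁺`. -/
theorem electric_near_origin_linear (G M q α : ℝ) (hG : 0 < G) (hq : 0 < q)
    (hα : 0 < α) :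
    Filter.Tendsto
      (fun r : ℝ =>
        ((1 - 2 * G * M / r + (2 * G * r ^ 2 / (3 * α ^ 2)) *
              (1 + 2 * q * α / r ^ 2) ^ ((3 : ℝ) / 2)
            - (2 * G * q / α) * (1 + r ^ 2 / (3 * q * α)))
          + 2 * G * (M - 2 * Real.sqrt 2 * (q * α) ^ ((3 : ℝ) / 2) / (3 * α ^ 2)) / r
          - (1 - 2 * G * q / α)) / r)
      (𝓝[>] 0) (𝓝 (G * Real.sqrt (2 * q * α) / α ^ 2)) := by
  have hc : 0 < 2 * q * α := by positivity
  have hs : 0 < √(2 * q * α) := Real.sqrt_pos.2 hc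
  have hM : 2 * √2 * (q * α) ^ ((3 : ℝ) / 2) = √(2 * q * α) ^ 3 := by
    rw [rpow_three_halves (by positivity), mul_assoc 2 q α, Real.sqrt_mul zero_le_two, mul_pow,
      pow_succ √2 2, Real.sq_sqrt zero_le_two]
  have hcont : ContinuousAt (fun r : ℝ =>
      2 * G / (3 * α ^ 2) * ((√(r ^ 2 + 2 * q * α) ^ 2 +
        √(r ^ 2 + 2 * q * α) * √(2 * q * α) + √(2 * q * α) ^ 2) /
          (√(r ^ 2 + 2 * q * α) + √(2 * q * α)) - r)) 0 := by
    refine continuousAt_const.mul (ContinuousAt.sub (ContinuousAt.div ?_ ?_ ?_) continuousAt_id)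
    · fun_prop
    · fun_prop
    · positivity
  have hlim := hcont.tendsto.mono_left (nhdsWithin_le_nhds (s := Set.Ioi (0 : ℝ)))
  have hval : 2 * G / (3 * α ^ 2) * ((√((0 : ℝ) ^ 2 + 2 * q * α) ^ 2 +
        √((0 : ℝ) ^ 2 + 2 * q * α) * √(2 * q * α) + √(2 * q * α) ^ 2) /
          (√((0 : ℝ) ^ 2 + 2 * q * α) + √(2 * q * α)) - 0) = G * √(2 * q * α) / α ^ 2 := by
    rw [zero_pow two_ne_zero, zero_add]
    field_simp
    ring
  rw [hval] at hlim
  refine hlim.congr' ?_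
  filter_upwards [self_mem_nhdsWithin] with r hr
  have hr : 0 < r := hr
  have hpow : (1 + 2 * q * α / r ^ 2) ^ ((3 : ℝ) / 2) = √(r ^ 2 + 2 * q * α) ^ 3 / r ^ 3 := by
    have hsplit : 1 + 2 * q * α / r ^ 2 = (r ^ 2 + 2 * q * α) / r ^ 2 := by field_simp
    rw [rpow_three_halves (by positivity), hsplit, Real.sqrt_div (by positivity),
      Real.sqrt_sq hr.le, div_pow]
  rw [hpow, hM]
  have ht : √(r ^ 2 + 2 * q * α) ^ 2 = r ^ 2 + √(2 * q * α) ^ 2 := by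
    rw [Real.sq_sqrt (by positivity), Real.sq_sqrt hc.le]
  have ht0 : 0 ≤ √(r ^ 2 + 2 * q * α) := Real.sqrt_nonneg _
  generalize √(r ^ 2 + 2 * q * α) = t at ht ht0 ⊢
  generalize √(2 * q * α) = s at hs ht ⊢
  have hcube : (t ^ 2 + t * s + s ^ 2) / (t + s) = (t ^ 3 - s ^ 3) / r ^ 2 := by
    rw [div_eq_div_iff (by positivity) (by positivity), eq_sub_of_add_eq ht.symm]
    ring
  rw [hcube]
  field_simp
  ring
end

section
/- Let G, M, q, α be real constants with G > 0, q > 0, α > 0, and let f(r) = 1 − 2GM/r + (2G r²/(3α²))·(1 + 2qα/r²)^{3/2} − (2Gq/α)·(1 + r²/(3qα)) for r > 0. Then lim_{r→∞} r²·( f(r) − 1 + 2GM/r ) = G q²; that is, at infinity f has the Reissner–Nordström expansion f(r) = 1 − 2GM/r + Gq²/r² + O(r⁻⁴). -/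
open Real Topology Filter

lemma rpow_three_halves_eq_sqrt_pow {y : ℝ} (hy : 0 ≤ y) :
    y ^ ((3 : ℝ) / 2) = √y ^ 3 := by
  rw [Real.sqrt_eq_rpow, ← Real.rpow_natCast, ← Real.rpow_mul hy]
  norm_num

/-- With `s = √(1 + 2qα/r²)`, the rescaled remainder of the metric function is rational in `s`. -/
lemma electric_remainder_eq (G M : ℝ) {q α r : ℝ} (hq : 0 < q) (hα : 0 < α) (hr : 0 < r) :
    r ^ 2 * ((1 - 2 * G * M / r + (2 * G * r ^ 2 / (3 * α ^ 2)) *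
          (1 + 2 * q * α / r ^ 2) ^ ((3 : ℝ) / 2)
        - (2 * G * q / α) * (1 + r ^ 2 / (3 * q * α)))
      - 1 + 2 * G * M / r) =
    4 * G * q ^ 2 / 3 * ((2 * √(1 + 2 * q * α / r ^ 2) + 1) /
      (√(1 + 2 * q * α / r ^ 2) + 1) ^ 2) := by
  have hy : 0 ≤ 1 + 2 * q * α / r ^ 2 := by positivity
  rw [rpow_three_halves_eq_sqrt_pow hy]
  have hsq := Real.sq_sqrt hy
  have hs := Real.sqrt_nonneg (1 + 2 * q * α / r ^ 2)
  generalize √(1 + 2 * q * α / r ^ 2) = s at hsq hs ⊢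
  have hs1 : s + 1 ≠ 0 := by positivity
  have hqs : q = r ^ 2 * (s ^ 2 - 1) / (2 * α) := by
    rw [hsq]
    field_simp
    ring
  have hlin : (2 * G * q / α) * (1 + r ^ 2 / (3 * q * α)) =
      2 * G * q / α + 2 * G * r ^ 2 / (3 * α ^ 2) := by
    field_simp
  rw [hlin, hqs]
  field_simp
  ring

/-- Reissner–Nordström asymptotics of the electrically charged (γ = 1/2) metric
function at infinity: `r² · (f(r) - 1 + 2GM/r) → G q²` as `r → ∞`. -/
theorem electric_infinity_RN (G M q α : ℝ) (hG : 0 < G) (hq : 0 < q) (hα : 0 < α) :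
    Filter.Tendsto
      (fun r : ℝ =>
        r ^ 2 * ((1 - 2 * G * M / r + (2 * G * r ^ 2 / (3 * α ^ 2)) *
              (1 + 2 * q * α / r ^ 2) ^ ((3 : ℝ) / 2)
            - (2 * G * q / α) * (1 + r ^ 2 / (3 * q * α)))
          - 1 + 2 * G * M / r))
      Filter.atTop (𝓝 (G * q ^ 2)) := by
  have hx : Tendsto (fun r : ℝ => 2 * q * α / r ^ 2) atTop (𝓝 0) :=
    (tendsto_pow_atTop two_ne_zero).const_div_atTop _
  have hs : Tendsto (fun r : ℝ => √(1 + 2 * q * α / r ^ 2)) atTop (𝓝 1) := by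
    simpa using (hx.const_add 1).sqrt
  have hlim := (((hs.const_mul 2).add_const 1).div ((hs.add_const 1).pow 2)
    (by norm_num)).const_mul (4 * G * q ^ 2 / 3)
  have hval : 4 * G * q ^ 2 / 3 * ((2 * 1 + 1) / (1 + 1) ^ 2) = G * q ^ 2 := by ring
  rw [hval] at hlim
  refine hlim.congr' ?_
  filter_upwards [eventually_gt_atTop 0] with r hr
  exact (electric_remainder_eq G M hq hα hr).symm
end
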